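/- There exists a universal constant $C > 0$ such that the following holds. Let $0 < \epsilon, \delta < 1/4$, let $v_1, \ldots, v_n \in \mathbb{C}^{d_1}$ be unit vectors, let $d_2 < d_1$ with $d_2$ dividing $d_1$ and $d_2 \geq C \epsilon^{-2} \log\frac{n d_1}{\delta}$, and suppose $m := 2^{-10}\epsilon^2 d_2$ is a positive integer. Let $V_1, \ldots, V_s$ be $d_1 \times d_1$ unitary matrices forming a $(d_1, s, \lambda, 2m)$-tensor product expander with $\lambda \leq \left(\frac{4\epsilon^2 d_2}{d_1^2}\right)^{m} e^{-m}$, and let $U$ be chosen uniformly at random from $\{V_1, \ldots, V_s\}$. For each block index $j$ and each $i \in [n]$ with $\Pi_j U v_i \neq 0$, define $v_i(j, U) := \frac{\Pi_j U v_i}{\|\Pi_j U v_i\|_2}$. Then with probability at least $1 - \delta$ over the choice of $U$, the following hold simultaneously: (a) $\|\Pi_j U v_i\|_2 \in [(1-\epsilon)\sqrt{d_2/d_1}, (1+\epsilon)\sqrt{d_2/d_1}]$ for all $i \in [n]$ and all $1 \leq j \leq d_1/d_2$; and (b) both the real and imaginary parts of $\langle v_i(j, U), v_{i'}(j, U) \rangle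 - \langle v_i, v_{i'} \rangle$ have absolute value at most $8\epsilon$, for all $i, i' \in [n]$ and all $1 \leq j \leq d_1/d_2$. -/

import Mathlib

open MeasureTheory Matrix

noncomputable section

/-- The Borel/product measurable structure on matrices over `ℂ`. -/
instance {d : ℕ} : MeasurableSpace (Matrix (Fin d) (Fin d) ℂ) :=
  inferInstanceAs (MeasurableSpace (Fin d → Fin d → ℂ))

/-- The Euclidean (`ℓ₂`) norm of a vector in `ℂ^d`. -/
def l2norm {d : ℕ} (v : Fin d → ℂ) : ℝ := Real.sqrt (∑ a, ‖v a‖ ^ 2)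

/-- The standard Hermitian inner product on `ℂ^d`, conjugate-linear in the first argument. -/
def hinner {d : ℕ} (u w : Fin d → ℂ) : ℂ := ∑ a, (starRingEnd ℂ) (u a) * w a

/-- The Frobenius (Hilbert–Schmidt, Schatten 2) norm of a square matrix over `ℂ`. -/
def frobNorm {m : Type*} [Fintype m] (M : Matrix m m ℂ) : ℝ :=
  Real.sqrt (∑ a, ∑ b, ‖M a b‖ ^ 2)

/-- The orthogonal projection of `ℂ^{d₁}` onto the (0-indexed) `j`-th consecutive block of
`d₂` coordinates. -/
def blockProj (d1 d2 j : ℕ) : Matrix (Fin d1) (Fin d1) ℂ :=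
  Matrix.diagonal fun a => if a.val / d2 = j then 1 else 0

/-- The `t`-fold tensor (Kronecker) power of a `d × d` matrix, as a matrix indexed by
`Fin t → Fin d`. -/
def tpow {d : ℕ} (M : Matrix (Fin d) (Fin d) ℂ) (t : ℕ) :
    Matrix (Fin t → Fin d) (Fin t → Fin d) ℂ :=
  Matrix.of fun a b => ∏ k, M (a k) (b k)

/-- The conjugation action `M ↦ U^{⊗t} M (U†)^{⊗t}`. -/
def conjAct {d : ℕ} (t : ℕ) (U : Matrix (Fin d) (Fin d) ℂ)
    (M : Matrix (Fin t → Fin d) (Fin t → Fin d) ℂ) :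
    Matrix (Fin t → Fin d) (Fin t → Fin d) ℂ :=
  tpow U t * M * tpow Uᴴ t

/-- The (entrywise) expectation `𝔼_{U ~ μ} [U^{⊗t} M (U†)^{⊗t}]` over a measure `μ` on the
unitary group. -/
def haarAvg {d : ℕ} (μ : Measure (Matrix.unitaryGroup (Fin d) ℂ)) (t : ℕ)
    (M : Matrix (Fin t → Fin d) (Fin t → Fin d) ℂ) :
    Matrix (Fin t → Fin d) (Fin t → Fin d) ℂ :=
  Matrix.of fun a b => ∫ U, conjAct t (U : Matrix (Fin d) (Fin d) ℂ) M a b ∂μ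

/-- `V : ι → U(d)` (with `s = |ι|` unitaries) is a `(d, s, λ, t)`-tensor product expander
with respect to the Haar measure `μ`. -/
def IsTPE {d : ℕ} {ι : Type*} [Fintype ι]
    (μ : Measure (Matrix.unitaryGroup (Fin d) ℂ)) (t : ℕ) (lam : ℝ)
    (V : ι → Matrix.unitaryGroup (Fin d) ℂ) : Prop :=
  ∀ M : Matrix (Fin t → Fin d) (Fin t → Fin d) ℂ,
    frobNorm ((Fintype.card ι : ℂ)⁻¹ •
        (∑ i, conjAct t ((V i : Matrix (Fin d) (Fin d) ℂ)) M) - haarAvg μ t M)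
      ≤ lam * frobNorm M

/-- The projection of `v` rotated by `U` onto the `j`-th block of `d₂` coordinates. -/
def projVec (d1 d2 j : ℕ) (U : Matrix.unitaryGroup (Fin d1) ℂ) (v : Fin d1 → ℂ) :
    Fin d1 → ℂ :=
  (blockProj d1 d2 j).mulVec ((U : Matrix (Fin d1) (Fin d1) ℂ).mulVec v)

/-- The normalized projection `v(j, U) = Π_j U v / ‖Π_j U v‖₂`. -/
def normProjVec (d1 d2 j : ℕ) (U : Matrix.unitaryGroup (Fin d1) ℂ) (v : Fin d1 → ℂ) :
    Fin d1 → ℂ :=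
  (l2norm (projVec d1 d2 j U v))⁻¹ • projVec d1 d2 j U v

/-- Sum of squared moduli over a set of coordinates. -/
def qS {d : ℕ} (B : Finset (Fin d)) (x : Fin d → ℂ) : ℝ := ∑ a ∈ B, ‖x a‖ ^ 2

/-- Givens rotation of coordinates `a`, `b`. -/
def giv {d : ℕ} (a b : Fin d) (θ : ℝ) : (Fin d → ℂ) →ₗ[ℂ] (Fin d → ℂ) where
  toFun x := fun i => if i = a then (Real.cos θ : ℂ) * x a + (Real.sin θ : ℂ) * x b
    else if i = b then -(Real.sin θ : ℂ) * x a + (Real.cos θ : ℂ) * x b else x i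
  map_add' x y := by
    funext i
    simp only [Pi.add_apply]
    split_ifs <;> ring
  map_smul' c x := by
    funext i
    simp only [Pi.smul_apply, smul_eq_mul, RingHom.id_apply]
    split_ifs <;> ring

lemma giv_apply {d : ℕ} (a b : Fin d) (θ : ℝ) (x : Fin d → ℂ) (i : Fin d) :
    giv a b θ x i = if i = a then (Real.cos θ : ℂ) * x a + (Real.sin θ : ℂ) * x b
    else if i = b then -(Real.sin θ : ℂ) * x a + (Real.cos θ : ℂ) * x b else x i := rfl

lemma giv_neg_comp {d : ℕ} {a b : Fin d} (hab : a ≠ b) (θ : ℝ) :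
    giv a b (-θ) ∘ₗ giv a b θ = LinearMap.id := by
  have h : (Real.sin θ : ℂ) ^ 2 + (Real.cos θ : ℂ) ^ 2 = 1 := by
    exact_mod_cast Real.sin_sq_add_cos_sq θ
  apply LinearMap.ext
  intro x
  funext i
  simp only [LinearMap.comp_apply, giv_apply, LinearMap.id_apply, Real.cos_neg, Real.sin_neg,
    if_true, hab.symm, if_false]
  split_ifs with h1 h2
  · subst h1; push_cast at *; linear_combination (x i) * h
  · subst h2; push_cast at *; linear_combination (x i) * h
  · rfl

lemma giv_conj {d : ℕ} {a b : Fin d} (hab : a ≠ b) (θ : ℝ) :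
    (LinearMap.toMatrix' (giv a b θ))ᴴ = LinearMap.toMatrix' (giv a b (-θ)) := by
  ext i j
  simp only [Matrix.conjTranspose_apply, LinearMap.toMatrix'_apply, giv_apply, Real.cos_neg,
    Real.sin_neg]
  by_cases h1 : i = a <;> by_cases h2 : i = b <;> by_cases h3 : j = a <;> by_cases h4 : j = b <;>
    simp_all [Pi.single_apply, Complex.conj_ofReal, ← Complex.ofReal_cos, ← Complex.ofReal_sin, eq_comm]

/-- Givens rotation as a unitary. -/
def givU {d : ℕ} {a b : Fin d} (hab : a ≠ b) (θ : ℝ) : Matrix.unitaryGroup (Fin d) ℂ :=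
  ⟨LinearMap.toMatrix' (giv a b θ), by
    rw [Matrix.mem_unitaryGroup_iff', Matrix.star_eq_conjTranspose, giv_conj hab,
      ← LinearMap.toMatrix'_comp, giv_neg_comp hab, LinearMap.toMatrix'_id]⟩

lemma givU_mulVec {d : ℕ} {a b : Fin d} (hab : a ≠ b) (θ : ℝ) (x : Fin d → ℂ) :
    (givU hab θ : Matrix (Fin d) (Fin d) ℂ).mulVec x = giv a b θ x := by
  simp only [givU]
  exact LinearMap.toMatrix'_mulVec _ _

/-- Phase rotation of coordinate `a`. -/
def pha {d : ℕ} (a : Fin d) (x : Fin d → ℂ) : Fin d → ℂ :=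
  fun i => if i = a then Complex.I * x i else x i

/-- Phase rotation as a unitary. -/
def phaU {d : ℕ} (a : Fin d) : Matrix.unitaryGroup (Fin d) ℂ :=
  ⟨Matrix.diagonal fun i => if i = a then Complex.I else 1, by
    rw [Matrix.mem_unitaryGroup_iff', Matrix.star_eq_conjTranspose, Matrix.diagonal_conjTranspose,
      Matrix.diagonal_mul_diagonal, ← Matrix.diagonal_one]
    congr 1
    funext i
    by_cases h : i = a <;> simp [h]⟩

lemma phaU_mulVec {d : ℕ} (a : Fin d) (x : Fin d → ℂ) :
    (phaU a : Matrix (Fin d) (Fin d) ℂ).mulVec x = pha a x := by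
  funext i
  simp only [phaU, pha, Matrix.mulVec_diagonal]
  split_ifs <;> simp

lemma measurable_qS {d : ℕ} (B : Finset (Fin d)) : Measurable (qS B) := by
  unfold qS; fun_prop

lemma measurable_giv {d : ℕ} (a b : Fin d) (θ : ℝ) : Measurable (giv a b θ) := by
  apply measurable_pi_lambda
  intro i
  simp only [giv_apply]
  split_ifs <;> fun_prop

lemma measurable_pha {d : ℕ} (a : Fin d) : Measurable (pha a) := by
  apply measurable_pi_lambda
  intro i
  simp only [pha]
  split_ifs <;> fun_prop

lemma qS_nonneg {d : ℕ} (B : Finset (Fin d)) (x : Fin d → ℂ) : 0 ≤ qS B x :=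
  Finset.sum_nonneg fun _ _ => by positivity

lemma qS_le {d : ℕ} (B : Finset (Fin d)) (x : Fin d → ℂ) : qS B x ≤ qS Finset.univ x :=
  Finset.sum_le_sum_of_subset_of_nonneg (Finset.subset_univ _) fun _ _ _ => by positivity

lemma sq_le_qS {d : ℕ} (x : Fin d → ℂ) (a : Fin d) : ‖x a‖ ^ 2 ≤ qS Finset.univ x :=
  Finset.single_le_sum (f := fun a => ‖x a‖ ^ 2) (fun _ _ => by positivity) (Finset.mem_univ a)

lemma qS_giv {d : ℕ} {a b : Fin d} (B : Finset (Fin d)) (ha : a ∈ B) (hb : b ∉ B) (θ : ℝ)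
    (x : Fin d → ℂ) :
    qS B (giv a b θ x) = qS B x - ‖x a‖ ^ 2 + (‖x a‖ ^ 2 + ‖x b‖ ^ 2) / 2
      + Real.cos (2 * θ) * ((‖x a‖ ^ 2 - ‖x b‖ ^ 2) / 2)
      + Real.sin (2 * θ) * ((starRingEnd ℂ) (x a) * x b).re := by
  have hab : a ≠ b := fun h => hb (h ▸ ha)
  unfold qS
  rw [← Finset.add_sum_erase B _ ha, ← Finset.add_sum_erase B (fun a => ‖x a‖ ^ 2) ha]
  have : ∑ i ∈ B.erase a, ‖giv a b θ x i‖ ^ 2 = ∑ i ∈ B.erase a, ‖x i‖ ^ 2 := by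
    apply Finset.sum_congr rfl
    intro i hi
    have h1 : i ≠ a := Finset.ne_of_mem_erase hi
    have h2 : i ≠ b := fun h => hb (h ▸ Finset.mem_of_mem_erase hi)
    simp [giv_apply, h1, h2]
  rw [this]
  simp only [giv_apply, if_true, Complex.sq_norm, Complex.normSq_apply, Complex.add_re,
    Complex.add_im, Complex.mul_re, Complex.mul_im, Complex.ofReal_re, Complex.ofReal_im,
    Complex.conj_re, Complex.conj_im, Real.cos_two_mul, Real.sin_two_mul]
  have h := Real.sin_sq_add_cos_sq θ
  have h2 : Real.sin θ ^ 2 = 1 - Real.cos θ ^ 2 := by linarith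
  ring_nf
  rw [h2]
  ring

lemma re_giv {d : ℕ} {a b : Fin d} (hab : a ≠ b) (θ : ℝ) (x : Fin d → ℂ) :
    ((starRingEnd ℂ) (giv a b θ x a) * giv a b θ x b).re =
      Real.cos (2 * θ) * ((starRingEnd ℂ) (x a) * x b).re
      + Real.sin (2 * θ) * ((‖x b‖ ^ 2 - ‖x a‖ ^ 2) / 2) := by
  simp only [giv_apply, if_true, hab.symm, if_false, Complex.sq_norm, Complex.normSq_apply,
    Complex.add_re, Complex.add_im, Complex.mul_re, Complex.mul_im, Complex.ofReal_re,
    Complex.ofReal_im, Complex.neg_re, Complex.neg_im,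
    Complex.conj_re, Complex.conj_im, Real.cos_two_mul, Real.sin_two_mul]
  have h := Real.sin_sq_add_cos_sq θ
  have h2 : Real.sin θ ^ 2 = 1 - Real.cos θ ^ 2 := by linarith
  ring_nf
  rw [h2]
  ring

/-- Invariant probability measure on the unit sphere. -/
structure SphInv {d : ℕ} (ν : Measure (Fin d → ℂ)) : Prop where
  sph : ∀ᵐ x ∂ν, qS Finset.univ x = 1
  giv : ∀ (a b : Fin d), a ≠ b → ∀ θ, ν.map (giv a b θ) = ν
  pha : ∀ a, ν.map (pha a) = ν

lemma SphInv.integrable {d : ℕ} {ν : Measure (Fin d → ℂ)} [IsProbabilityMeasure ν]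
    (hν : SphInv ν) {F : (Fin d → ℂ) → ℝ} (hF : Measurable F) (K : ℝ)
    (hK : ∀ x, qS Finset.univ x = 1 → |F x| ≤ K) : Integrable F ν := by
  apply Integrable.of_bound hF.aestronglyMeasurable K
  filter_upwards [hν.sph] with x hx
  exact hK x hx

lemma abs_re_le {d : ℕ} (x : Fin d → ℂ) (hx : qS Finset.univ x = 1) (a b : Fin d) :
    |((starRingEnd ℂ) (x a) * x b).re| ≤ 1 := by
  refine (Complex.abs_re_le_norm _).trans ?_
  have h1 := sq_le_qS x a
  have h2 := sq_le_qS x b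
  rw [hx] at h1 h2
  have h3 : ‖x a‖ ≤ 1 := by nlinarith [norm_nonneg (x a)]
  have h4 : ‖x b‖ ≤ 1 := by nlinarith [norm_nonneg (x b)]
  rw [norm_mul, Complex.norm_conj]
  nlinarith [norm_nonneg (x a), norm_nonneg (x b)]

lemma hasDeriv_aux (q A T : ℝ) (n : ℕ) (θ : ℝ) :
    HasDerivAt (fun θ : ℝ => (Real.cos (2 * θ) * q + Real.sin (2 * θ) * A) *
        (T - Real.cos (2 * θ) * A + Real.sin (2 * θ) * q) ^ (n + 1))
      ((2 * Real.cos (2 * θ) * A - 2 * Real.sin (2 * θ) * q) *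
        (T - Real.cos (2 * θ) * A + Real.sin (2 * θ) * q) ^ (n + 1) +
        2 * (n + 1) * (Real.cos (2 * θ) * q + Real.sin (2 * θ) * A) ^ 2 *
        (T - Real.cos (2 * θ) * A + Real.sin (2 * θ) * q) ^ n) θ := by
  have h0 : HasDerivAt (fun θ : ℝ => 2 * θ) 2 θ := by
    simpa using (hasDerivAt_id θ).const_mul (2 : ℝ)
  have hc := h0.cos
  have hs := h0.sin
  have h1 := (hc.mul_const q).add (hs.mul_const A)
  have h2 := (((hc.mul_const A).const_sub T).add (hs.mul_const q)).pow (n + 1)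
  refine (h1.mul h2).congr_deriv ?_
  simp only [Pi.add_apply, Pi.pow_apply, Nat.add_sub_cancel]
  push_cast
  ring

lemma abs_aux (q A T c s : ℝ) (n : ℕ) (hq : |q| ≤ 1) (hA : |A| ≤ 1) (hT : |T| ≤ 3)
    (hc : |c| ≤ 1) (hs : |s| ≤ 1) :
    |(2 * c * A - 2 * s * q) * (T - c * A + s * q) ^ (n + 1) +
        2 * (n + 1) * (c * q + s * A) ^ 2 * (T - c * A + s * q) ^ n|
      ≤ (4 : ℝ) * 5 ^ (n + 1) + 2 * ((n : ℝ) + 1) * 2 ^ 2 * 5 ^ n := by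
  have m1 : ∀ u w : ℝ, |u| ≤ 1 → |w| ≤ 1 → |u * w| ≤ 1 := fun u w hu hw => by
    rw [abs_mul]; nlinarith [abs_nonneg u, abs_nonneg w]
  have e1 := abs_le.1 (m1 c A hc hA)
  have e2 := abs_le.1 (m1 s q hs hq)
  have e3 := abs_le.1 (m1 c q hc hq)
  have e4 := abs_le.1 (m1 s A hs hA)
  have e5 := abs_le.1 hT
  have f1 : |2 * c * A - 2 * s * q| ≤ 4 := by rw [abs_le]; constructor <;> linarith
  have f2 : |T - c * A + s * q| ≤ 5 := by rw [abs_le]; constructor <;> linarith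
  have f3 : |c * q + s * A| ≤ 2 := by rw [abs_le]; constructor <;> linarith
  refine (abs_add_le _ _).trans ?_
  rw [abs_mul, abs_mul, abs_mul, abs_pow, abs_pow, abs_pow, abs_of_nonneg (by positivity : (0:ℝ) ≤ 2 * (n + 1))]
  gcongr

lemma stein_real {d : ℕ} {ν : Measure (Fin d → ℂ)} [IsProbabilityMeasure ν]
    (hν : SphInv ν) (B : Finset (Fin d)) (p : ℝ) (hp0 : 0 ≤ p) (hp1 : p ≤ 1)
    {a b : Fin d} (ha : a ∈ B) (hb : b ∉ B) (n : ℕ) :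
    ∫ x, ((‖x b‖ ^ 2 - ‖x a‖ ^ 2) * (qS B x - p) ^ (n + 1) +
      2 * (n + 1) * ((starRingEnd ℂ) (x a) * x b).re ^ 2 * (qS B x - p) ^ n) ∂ν = 0 := by
  have hab : a ≠ b := fun h => hb (h ▸ ha)
  have hqm := measurable_qS B
  have hrm : Measurable fun x : Fin d → ℂ => ((starRingEnd ℂ) (x a) * x b).re := by
    have : Continuous fun x : Fin d → ℂ => ((starRingEnd ℂ) (x a) * x b).re := by fun_prop
    exact this.measurable
  let q : (Fin d → ℂ) → ℝ := fun x => ((starRingEnd ℂ) (x a) * x b).re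
  let A : (Fin d → ℂ) → ℝ := fun x => (‖x b‖ ^ 2 - ‖x a‖ ^ 2) / 2
  let T : (Fin d → ℂ) → ℝ := fun x => qS B x - p - ‖x a‖ ^ 2 + (‖x a‖ ^ 2 + ‖x b‖ ^ 2) / 2
  have hAm : Measurable A := by fun_prop
  have hTm : Measurable T := by fun_prop
  have hqm' : Measurable q := hrm
  let G : (Fin d → ℂ) → ℝ := fun x => q x * (qS B x - p) ^ (n + 1)
  have hGm : Measurable G := by fun_prop
  let F : ℝ → (Fin d → ℂ) → ℝ := fun θ x => (Real.cos (2 * θ) * q x + Real.sin (2 * θ) * A x) *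
        (T x - Real.cos (2 * θ) * A x + Real.sin (2 * θ) * q x) ^ (n + 1)
  let F' : ℝ → (Fin d → ℂ) → ℝ := fun θ x =>
    (2 * Real.cos (2 * θ) * A x - 2 * Real.sin (2 * θ) * q x) *
        (T x - Real.cos (2 * θ) * A x + Real.sin (2 * θ) * q x) ^ (n + 1) +
        2 * (n + 1) * (Real.cos (2 * θ) * q x + Real.sin (2 * θ) * A x) ^ 2 *
        (T x - Real.cos (2 * θ) * A x + Real.sin (2 * θ) * q x) ^ n
  have hFG : ∀ θ x, F θ x = G (giv a b θ x) := by
    intro θ x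
    simp only [F, G, q, A, T]
    rw [re_giv hab, qS_giv B ha hb]
    congr 2
    ring
  have hFm : ∀ θ, Measurable (F θ) := fun θ => by fun_prop
  have hF'm : ∀ θ, Measurable (F' θ) := fun θ => by fun_prop
  have hbq : ∀ x, qS Finset.univ x = 1 → |q x| ≤ 1 ∧ |A x| ≤ 1 ∧ |T x| ≤ 3 := by
    intro x hx
    have h1 := sq_le_qS x a
    have h2 := sq_le_qS x b
    have h3 := qS_le B x
    have h4 := qS_nonneg B x
    have h5 : 0 ≤ ‖x a‖ ^ 2 := by positivity
    have h6 : 0 ≤ ‖x b‖ ^ 2 := by positivity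
    rw [hx] at h1 h2 h3
    refine ⟨abs_re_le x hx a b, ?_, ?_⟩
    · simp only [A]; rw [abs_le]; constructor <;> linarith
    · simp only [T]; rw [abs_le]; constructor <;> linarith
  have hF0 : Integrable (F 0) ν := by
    apply hν.integrable (hFm 0) (1 * 1 ^ (n + 1))
    intro x hx
    rw [hFG, show giv a b 0 x = x from by
      funext i
      rw [giv_apply]
      split_ifs with h1 h2
      · simp [h1]
      · simp [h2]
      · rfl]
    simp only [G]
    rw [abs_mul, abs_pow]
    have h3 := qS_le B x
    have h4 := qS_nonneg B x
    rw [hx] at h3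
    have : |qS B x - p| ≤ 1 := by rw [abs_le]; constructor <;> linarith
    have := (hbq x hx).1
    gcongr
  have key := (hasDerivAt_integral_of_dominated_loc_of_deriv_le (μ := ν) (F := F) (F' := F')
    (x₀ := (0:ℝ)) (s := Set.univ) (bound := fun _ => 4 * 5 ^ (n + 1) + 2 * (n + 1) * 2 ^ 2 * 5 ^ n)
    Filter.univ_mem
    (Filter.Eventually.of_forall fun θ => (hFm θ).aestronglyMeasurable) hF0
    (hF'm 0).aestronglyMeasurable
    (by
      filter_upwards [hν.sph] with x hx θ _
      obtain ⟨h1, h2, h3⟩ := hbq x hx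
      exact abs_aux _ _ _ _ _ n h1 h2 h3 (Real.abs_cos_le_one _) (Real.abs_sin_le_one _))
    (integrable_const _)
    (by
      filter_upwards with x θ _
      exact hasDeriv_aux _ _ _ _ _)).2
  have hconst : (fun θ => ∫ x, F θ x ∂ν) = fun _ => ∫ x, G x ∂ν := by
    funext θ
    conv_rhs => rw [← hν.giv a b hab θ]
    rw [integral_map (measurable_giv a b θ).aemeasurable hGm.aestronglyMeasurable]
    exact integral_congr_ae (Filter.Eventually.of_forall fun x => hFG θ x)
  rw [hconst] at key
  have h0 := key.unique (hasDerivAt_const (0:ℝ) (∫ x, G x ∂ν))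
  rw [← h0]
  apply integral_congr_ae
  filter_upwards with x
  simp only [F', q, A, T]
  simp only [mul_zero, Real.cos_zero, Real.sin_zero]
  ring

lemma qS_pha {d : ℕ} (B : Finset (Fin d)) (a : Fin d) (x : Fin d → ℂ) :
    qS B (pha a x) = qS B x := by
  unfold qS
  apply Finset.sum_congr rfl
  intro i _
  simp only [pha]
  split_ifs <;> simp

lemma stein_pair {d : ℕ} {ν : Measure (Fin d → ℂ)} [IsProbabilityMeasure ν]
    (hν : SphInv ν) (B : Finset (Fin d)) (p : ℝ) (hp0 : 0 ≤ p) (hp1 : p ≤ 1)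
    {a b : Fin d} (ha : a ∈ B) (hb : b ∉ B) (n : ℕ) :
    ∫ x, ((‖x b‖ ^ 2 - ‖x a‖ ^ 2) * (qS B x - p) ^ (n + 1) +
      (n + 1) * (‖x a‖ ^ 2 * ‖x b‖ ^ 2) * (qS B x - p) ^ n) ∂ν = 0 := by
  have hab : a ≠ b := fun h => hb (h ▸ ha)
  have hqm := measurable_qS B
  have hrm : Measurable fun x : Fin d → ℂ => ((starRingEnd ℂ) (x a) * x b).re := by
    have : Continuous fun x : Fin d → ℂ => ((starRingEnd ℂ) (x a) * x b).re := by fun_prop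
    exact this.measurable
  let K : (Fin d → ℂ) → ℝ := fun x => (n + 1) *
    (2 * ((starRingEnd ℂ) (x a) * x b).re ^ 2 - ‖x a‖ ^ 2 * ‖x b‖ ^ 2) * (qS B x - p) ^ n
  have hKm : Measurable K := by fun_prop
  have hK : ∀ x, K (pha a x) = - K x := by
    intro x
    simp only [K, qS_pha, pha, if_true, hab.symm, if_false, Complex.sq_norm, Complex.normSq_apply,
      Complex.mul_re, Complex.mul_im, Complex.I_re, Complex.I_im, Complex.conj_re, Complex.conj_im]
    ring
  have hK0 : ∫ x, K x ∂ν = 0 := by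
    have : ∫ x, K x ∂ν = - ∫ x, K x ∂ν := by
      conv_lhs => rw [← hν.pha a]
      rw [integral_map (measurable_pha a).aemeasurable hKm.aestronglyMeasurable]
      simp only [hK, integral_neg]
    linarith
  have hb : ∀ x, qS Finset.univ x = 1 → ‖x a‖ ^ 2 ≤ 1 ∧ ‖x b‖ ^ 2 ≤ 1 ∧ |qS B x - p| ≤ 1 ∧
      |((starRingEnd ℂ) (x a) * x b).re| ≤ 1 := by
    intro x hx
    have h1 := sq_le_qS x a
    have h2 := sq_le_qS x b
    have h3 := qS_le B x
    have h4 := qS_nonneg B x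
    rw [hx] at h1 h2 h3
    refine ⟨h1, h2, ?_, abs_re_le x hx a b⟩
    rw [abs_le]; constructor <;> linarith
  have hKi : Integrable K ν := by
    apply hν.integrable hKm ((n + 1) * 3 * 1 ^ n)
    intro x hx
    obtain ⟨h1, h2, h3, h4⟩ := hb x hx
    simp only [K]
    rw [abs_mul, abs_mul, abs_pow, abs_of_nonneg (by positivity : (0:ℝ) ≤ n + 1)]
    have h5 : |2 * ((starRingEnd ℂ) (x a) * x b).re ^ 2 - ‖x a‖ ^ 2 * ‖x b‖ ^ 2| ≤ 3 := by
      have : ((starRingEnd ℂ) (x a) * x b).re ^ 2 ≤ 1 := by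
        rw [← sq_abs]; nlinarith [abs_nonneg ((starRingEnd ℂ) (x a) * x b).re]
      have h6 : 0 ≤ ‖x a‖ ^ 2 * ‖x b‖ ^ 2 := by positivity
      have h7 : ‖x a‖ ^ 2 * ‖x b‖ ^ 2 ≤ 1 := mul_le_one₀ h1 (by positivity) h2
      rw [abs_le]; constructor <;> nlinarith [sq_nonneg ((starRingEnd ℂ) (x a) * x b).re]
    gcongr
  have hS := stein_real hν B p hp0 hp1 ha ‹b ∉ B› n
  rw [← sub_zero (∫ x, _ ∂ν)]
  have hSi : Integrable (fun x : Fin d → ℂ => ((‖x b‖ ^ 2 - ‖x a‖ ^ 2) * (qS B x - p) ^ (n + 1) +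
      2 * (n + 1) * ((starRingEnd ℂ) (x a) * x b).re ^ 2 * (qS B x - p) ^ n)) ν := by
    apply hν.integrable (by fun_prop) (1 * 1 ^ (n + 1) + 2 * (n + 1) * 1 ^ 2 * 1 ^ n)
    intro x hx
    obtain ⟨h1, h2, h3, h4⟩ := hb x hx
    refine (abs_add_le _ _).trans ?_
    rw [abs_mul, abs_mul, abs_mul, abs_pow, abs_pow, abs_pow,
      abs_of_nonneg (by positivity : (0:ℝ) ≤ 2 * (n + 1))]
    have : |‖x b‖ ^ 2 - ‖x a‖ ^ 2| ≤ 1 := by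
      have h5 : 0 ≤ ‖x a‖ ^ 2 := by positivity
      have h6 : 0 ≤ ‖x b‖ ^ 2 := by positivity
      rw [abs_le]; constructor <;> linarith
    gcongr
  have e := integral_sub hSi hKi
  rw [hS, hK0] at e
  rw [sub_zero, ← sub_zero (0:ℝ), ← e]
  apply integral_congr_ae
  filter_upwards with x
  simp only [K]
  ring

lemma sphInv_bound {d : ℕ} (B : Finset (Fin d)) (p : ℝ) (hp0 : 0 ≤ p) (hp1 : p ≤ 1)
    (x : Fin d → ℂ) (hx : qS Finset.univ x = 1) :
    |qS B x - p| ≤ 1 ∧ 0 ≤ qS B x ∧ qS B x ≤ 1 := by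
  have h3 := qS_le B x
  have h4 := qS_nonneg B x
  rw [hx] at h3
  refine ⟨?_, h4, h3⟩
  rw [abs_le]; constructor <;> linarith

lemma pair_sum (d : ℕ) (B : Finset (Fin d)) (x : Fin d → ℂ) (hx : qS Finset.univ x = 1)
    (u w : ℝ) :
    ∑ a ∈ B, ∑ b ∈ Bᶜ, ((‖x b‖ ^ 2 - ‖x a‖ ^ 2) * u + (‖x a‖ ^ 2 * ‖x b‖ ^ 2) * w) =
      (B.card - d * qS B x) * u + (qS B x * (1 - qS B x)) * w := by
  have h1 : ∑ b ∈ Bᶜ, ‖x b‖ ^ 2 = 1 - qS B x := by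
    rw [← hx]; unfold qS
    rw [← Finset.sum_add_sum_compl B]; ring
  have h2 : ((Bᶜ).card : ℝ) = d - B.card := by
    rw [Finset.card_compl, Nat.cast_sub (Finset.card_le_univ B)]
    simp
  have h3 : ∑ b ∈ B, ‖x b‖ ^ 2 = qS B x := rfl
  simp only [Finset.sum_add_distrib, ← Finset.sum_mul, ← Finset.mul_sum, Finset.sum_sub_distrib,
    Finset.sum_const, nsmul_eq_mul, h1, h2, h3]
  ring

lemma stein_sum {d : ℕ} {ν : Measure (Fin d → ℂ)} [IsProbabilityMeasure ν]
    (hν : SphInv ν) (B : Finset (Fin d)) (p : ℝ) (hp0 : 0 ≤ p) (hp1 : p ≤ 1) (n : ℕ) :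
    ∫ x, ((B.card - d * qS B x) * (qS B x - p) ^ (n + 1) +
      (qS B x * (1 - qS B x)) * ((n + 1) * (qS B x - p) ^ n)) ∂ν = 0 := by
  have hqm := measurable_qS B
  let f : Fin d → Fin d → (Fin d → ℂ) → ℝ := fun a b x =>
    (‖x b‖ ^ 2 - ‖x a‖ ^ 2) * (qS B x - p) ^ (n + 1) +
      (n + 1) * (‖x a‖ ^ 2 * ‖x b‖ ^ 2) * (qS B x - p) ^ n
  have hfi : ∀ a b, Integrable (f a b) ν := by
    intro a b
    apply hν.integrable (by fun_prop) (1 * 1 ^ (n + 1) + (n + 1) * (1 * 1) * 1 ^ n)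
    intro x hx
    have h1 := sq_le_qS x a
    have h2 := sq_le_qS x b
    rw [hx] at h1 h2
    have h3 := (sphInv_bound B p hp0 hp1 x hx).1
    have : |‖x b‖ ^ 2 - ‖x a‖ ^ 2| ≤ 1 := by
      have h5 : 0 ≤ ‖x a‖ ^ 2 := by positivity
      have h6 : 0 ≤ ‖x b‖ ^ 2 := by positivity
      rw [abs_le]; constructor <;> linarith
    refine (abs_add_le _ _).trans ?_
    rw [abs_mul, abs_mul, abs_pow, abs_pow,
      abs_of_nonneg (by positivity : (0:ℝ) ≤ (n + 1) * (‖x a‖ ^ 2 * ‖x b‖ ^ 2))]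
    gcongr
  have h0 : ∑ a ∈ B, ∑ b ∈ Bᶜ, ∫ x, f a b x ∂ν = 0 := by
    apply Finset.sum_eq_zero
    intro a ha
    apply Finset.sum_eq_zero
    intro b hb
    exact stein_pair hν B p hp0 hp1 ha (Finset.mem_compl.1 hb) n
  rw [← h0]
  simp_rw [← integral_finset_sum _ (fun b _ => hfi _ b)]
  rw [← integral_finset_sum _ (fun a _ => integrable_finset_sum _ (fun b _ => hfi a b))]
  apply integral_congr_ae
  filter_upwards [hν.sph] with x hx
  rw [← pair_sum d B x hx]
  apply Finset.sum_congr rfl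
  intro a _
  apply Finset.sum_congr rfl
  intro b _
  simp only [f]
  ring

lemma moment_step {d : ℕ} {ν : Measure (Fin d → ℂ)} [IsProbabilityMeasure ν]
    (hν : SphInv ν) (B : Finset (Fin d)) (p : ℝ) (hp0 : 0 < p) (hp1 : p ≤ 1)
    (hd : 0 < d) (hpd : p = B.card / d) (k m : ℕ) (hk : k + 1 ≤ m)
    (hm : (m : ℝ) ≤ p * d) :
    ∫ x, (qS B x - p) ^ (2 * (k + 1)) ∂ν ≤ (8 * m * p / d) * ∫ x, (qS B x - p) ^ (2 * k) ∂ν := by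
  have hqm := measurable_qS B
  have hd' : (0:ℝ) < d := by exact_mod_cast hd
  have hBd : (B.card : ℝ) = p * d := by rw [hpd]; field_simp
  have hpi : ∀ j, Integrable (fun x => (qS B x - p) ^ j) ν := by
    intro j
    apply hν.integrable (by fun_prop) (1 ^ j)
    intro x hx
    rw [abs_pow]
    have := (sphInv_bound B p hp0.le hp1 x hx).1
    gcongr
  have hS := stein_sum hν B p hp0.le hp1 (2 * k)
  have h1 : ∫ x, (d * (qS B x - p) ^ (2 * (k + 1)) - (2 * k + 1) *
      (2 * p * (qS B x - p) ^ (2 * k) + (qS B x - p) ^ (2 * (k + 1)) / (4 * p))) ∂ν ≤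
      - ∫ x, ((B.card - d * qS B x) * (qS B x - p) ^ (2 * k + 1) +
      (qS B x * (1 - qS B x)) * (((2 * k : ℕ) + 1) * (qS B x - p) ^ (2 * k))) ∂ν := by
    rw [← integral_neg]
    apply integral_mono_ae
    · exact ((hpi _).const_mul _).sub ((((hpi _).const_mul _).add ((hpi _).div_const _)).const_mul _)
    · have hq : ∀ j, Integrable (fun x => qS B x * (qS B x - p) ^ j) ν := by
        intro j
        apply hν.integrable (by fun_prop) (1 * 1 ^ j)
        intro x hx
        obtain ⟨h1, h2, h3⟩ := sphInv_bound B p hp0.le hp1 x hx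
        rw [abs_mul, abs_pow, abs_of_nonneg h2]
        gcongr
      have := hq (2 * k + 1)
      apply hν.integrable (by fun_prop) ((2 * d) * 1 ^ (2 * k + 1) + (1 * 1) * (((2 * k : ℕ) + 1) * 1 ^ (2 * k)))
      intro x hx
      obtain ⟨h1, h2, h3⟩ := sphInv_bound B p hp0.le hp1 x hx
      rw [abs_neg]
      refine (abs_add_le _ _).trans ?_
      rw [abs_mul, abs_mul, abs_mul, abs_mul, abs_pow, abs_pow, abs_of_nonneg h2,
        abs_of_nonneg (by positivity : (0:ℝ) ≤ ((2 * k : ℕ) : ℝ) + 1)]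
      have e1 : |1 - qS B x| ≤ 1 := by rw [abs_le]; constructor <;> linarith
      have e2 : |(B.card : ℝ) - d * qS B x| ≤ 2 * d := by
        rw [hBd, abs_le]; constructor <;> nlinarith
      gcongr
    · filter_upwards [hν.sph] with x hx
      obtain ⟨h1, h2, h3⟩ := sphInv_bound B p hp0.le hp1 x hx
      rw [hBd]
      set y := qS B x - p with hy
      have hx' : qS B x = p + y := by rw [hy]; ring
      have hyk : 0 ≤ y ^ (2 * k) := by rw [pow_mul]; positivity
      have e1 : y ^ (2 * (k + 1)) = y ^ 2 * y ^ (2 * k) := by ring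
      have e2 : y ^ (2 * k + 1) = y * y ^ (2 * k) := by ring
      have e3 : qS B x * (1 - qS B x) ≤ 2 * p + y ^ 2 / (4 * p) := by
        have : qS B x * (1 - qS B x) ≤ qS B x := by nlinarith
        refine this.trans ?_
        rw [hx']
        have : y ≤ p + y ^ 2 / (4 * p) := by
          have h : p + y ^ 2 / (4 * p) - y = (2 * p - y) ^ 2 / (4 * p) := by
            field_simp; ring
          have : 0 ≤ (2 * p - y) ^ 2 / (4 * p) := by positivity
          linarith
        linarith
      have e4 := mul_le_mul_of_nonneg_right e3
        (by positivity : 0 ≤ (2 * (k:ℝ) + 1) * y ^ (2 * k))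
      push_cast
      rw [e1, e2]
      have e5 : (p * (d:ℝ) - d * qS B x) = - d * y := by rw [hx']; ring
      rw [e5]
      have e6 : y ^ 2 * y ^ (2 * k) / (4 * p) = y ^ 2 / (4 * p) * y ^ (2 * k) := by ring
      rw [e6]
      nlinarith [e4]
  have hsum : Integrable (fun x => 2 * p * (qS B x - p) ^ (2 * k) +
      (qS B x - p) ^ (2 * (k + 1)) / (4 * p)) ν := ((hpi _).const_mul _).add ((hpi _).div_const _)
  rw [hS, integral_sub ((hpi _).const_mul _) (hsum.const_mul _), integral_const_mul,
    integral_const_mul, integral_add ((hpi _).const_mul _) ((hpi _).div_const _),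
    integral_const_mul, integral_div] at h1
  have hM1 : 0 ≤ ∫ x, (qS B x - p) ^ (2 * (k + 1)) ∂ν :=
    integral_nonneg fun x => by simp only [pow_mul]; positivity
  have hM0 : 0 ≤ ∫ x, (qS B x - p) ^ (2 * k) ∂ν :=
    integral_nonneg fun x => by simp only [pow_mul]; positivity
  set M1 := ∫ x, (qS B x - p) ^ (2 * (k + 1)) ∂ν
  set M0 := ∫ x, (qS B x - p) ^ (2 * k) ∂ν
  have hkm : 2 * (k:ℝ) + 1 ≤ 2 * m := by
    have : (k:ℝ) + 1 ≤ m := by exact_mod_cast hk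
    linarith
  have h2 : d * M1 ≤ 2 * m * (2 * p * M0 + M1 / (4 * p)) := by
    have : (2 * (k:ℝ) + 1) * (2 * p * M0 + M1 / (4 * p)) ≤ 2 * m * (2 * p * M0 + M1 / (4 * p)) := by
      gcongr
    linarith
  have h3 : 2 * m * (M1 / (4 * p)) ≤ d / 2 * M1 := by
    have : 2 * m * (M1 / (4 * p)) = (m * M1 / 2) / p := by field_simp; ring
    rw [this, div_le_iff₀ hp0]
    nlinarith [mul_le_mul_of_nonneg_right hm hM1]
  have h4 : d * M1 ≤ 8 * m * p * M0 := by nlinarith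
  rw [div_mul_eq_mul_div, le_div_iff₀ hd']
  linarith

lemma moment_bound {d : ℕ} {ν : Measure (Fin d → ℂ)} [IsProbabilityMeasure ν]
    (hν : SphInv ν) (B : Finset (Fin d)) (p : ℝ) (hp0 : 0 < p) (hp1 : p ≤ 1)
    (hd : 0 < d) (hpd : p = B.card / d) (m : ℕ) (hm : (m : ℝ) ≤ p * d) :
    ∫ x, (qS B x - p) ^ (2 * m) ∂ν ≤ (8 * m * p / d) ^ m := by
  have : ∀ k, k ≤ m → ∫ x, (qS B x - p) ^ (2 * k) ∂ν ≤ (8 * m * p / d) ^ k := by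
    intro k
    induction k with
    | zero => intro _; simp
    | succ k ih =>
      intro hk
      refine (moment_step hν B p hp0 hp1 hd hpd k m hk hm).trans ?_
      rw [pow_succ', ]
      have := ih (by omega)
      gcongr
  exact this m le_rfl

lemma unitary_qS {d : ℕ} (U : Matrix.unitaryGroup (Fin d) ℂ) (v : Fin d → ℂ) :
    qS Finset.univ ((U : Matrix (Fin d) (Fin d) ℂ).mulVec v) = qS Finset.univ v := by
  have h : ∀ w : Fin d → ℂ, ((qS Finset.univ w : ℝ) : ℂ) = star w ⬝ᵥ w := by
    intro w
    simp only [qS, dotProduct, Pi.star_apply]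
    push_cast
    apply Finset.sum_congr rfl
    intro a _
    rw [← Complex.conj_mul']
    rfl
  have : ((qS Finset.univ ((U : Matrix (Fin d) (Fin d) ℂ).mulVec v) : ℝ) : ℂ)
      = ((qS Finset.univ v : ℝ) : ℂ) := by
    rw [h, h, Matrix.star_mulVec, ← Matrix.dotProduct_mulVec, Matrix.mulVec_mulVec,
      ← Matrix.star_eq_conjTranspose, Matrix.UnitaryGroup.star_mul_self, Matrix.one_mulVec]
  exact_mod_cast this

lemma measurable_mv {d : ℕ} (v : Fin d → ℂ) : Measurable
    fun U : Matrix.unitaryGroup (Fin d) ℂ => (U : Matrix (Fin d) (Fin d) ℂ).mulVec v := by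
  apply measurable_pi_lambda
  intro i
  simp only [Matrix.mulVec, dotProduct]
  apply Finset.measurable_sum
  intro j _
  apply Measurable.mul_const
  have : Measurable fun M : Matrix (Fin d) (Fin d) ℂ => M i j :=
    (measurable_pi_apply (X := fun _ : Fin d => ℂ) j).comp
      (measurable_pi_apply (X := fun _ : Fin d => Fin d → ℂ) i)
  exact this.comp measurable_subtype_coe

lemma measurable_lmul {d : ℕ} (W : Matrix.unitaryGroup (Fin d) ℂ) : Measurable
    fun U : Matrix.unitaryGroup (Fin d) ℂ => W * U := by
  apply Measurable.subtype_mk (p := fun M => M ∈ Matrix.unitaryGroup (Fin d) ℂ)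
    (f := fun U : Matrix.unitaryGroup (Fin d) ℂ => (W : Matrix (Fin d) (Fin d) ℂ) * U)
  refine measurable_pi_lambda (X := fun _ : Fin d => Fin d → ℂ) _ fun i => ?_
  refine measurable_pi_lambda _ fun j => ?_
  simp only [Matrix.mul_apply]
  apply Finset.measurable_sum
  intro k _
  apply Measurable.const_mul
  have : Measurable fun M : Matrix (Fin d) (Fin d) ℂ => M k j :=
    (measurable_pi_apply (X := fun _ : Fin d => ℂ) j).comp
      (measurable_pi_apply (X := fun _ : Fin d => Fin d → ℂ) k)
  exact this.comp measurable_subtype_coe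

lemma sphInv_map {d : ℕ} (μ : Measure (Matrix.unitaryGroup (Fin d) ℂ))
    (hμ : ∀ V : Matrix.unitaryGroup (Fin d) ℂ, μ.map (fun U => V * U) = μ)
    (v : Fin d → ℂ) (hv : qS Finset.univ v = 1) :
    SphInv (μ.map fun U : Matrix.unitaryGroup (Fin d) ℂ =>
      (U : Matrix (Fin d) (Fin d) ℂ).mulVec v) := by
  have key : ∀ (W : Matrix.unitaryGroup (Fin d) ℂ) (T : (Fin d → ℂ) → (Fin d → ℂ)),
      Measurable T → (∀ x, (W : Matrix (Fin d) (Fin d) ℂ).mulVec x = T x) →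
      (μ.map fun U : Matrix.unitaryGroup (Fin d) ℂ =>
      (U : Matrix (Fin d) (Fin d) ℂ).mulVec v).map T = μ.map fun U : Matrix.unitaryGroup (Fin d) ℂ =>
      (U : Matrix (Fin d) (Fin d) ℂ).mulVec v := by
    intro W T hT hWT
    conv_rhs => rw [← hμ W]
    rw [Measure.map_map hT (measurable_mv v), Measure.map_map (measurable_mv v) (measurable_lmul W)]
    congr 1
    funext U
    simp only [Function.comp_apply, ← hWT, Matrix.mulVec_mulVec]
    rfl
  refine ⟨?_, ?_, ?_⟩
  · rw [ae_map_iff (measurable_mv v).aemeasurable]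
    · filter_upwards with U
      rw [unitary_qS, hv]
    · exact measurableSet_eq_fun (measurable_qS _) measurable_const
  · intro a b hab θ
    exact key (givU hab θ) _ (measurable_giv a b θ) (givU_mulVec hab θ)
  · intro a
    exact key (phaU a) _ (measurable_pha a) (phaU_mulVec a)

lemma haar_moment {d : ℕ} (μ : Measure (Matrix.unitaryGroup (Fin d) ℂ)) [IsProbabilityMeasure μ]
    (hμ : ∀ V : Matrix.unitaryGroup (Fin d) ℂ, μ.map (fun U => V * U) = μ)
    (v : Fin d → ℂ) (hv : qS Finset.univ v = 1) (B : Finset (Fin d)) (p : ℝ) (hp0 : 0 < p)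
    (hp1 : p ≤ 1)
    (hd : 0 < d) (hpd : p = B.card / d) (m : ℕ) (hm : (m : ℝ) ≤ p * d) :
    ∫ U : Matrix.unitaryGroup (Fin d) ℂ,
      (qS B ((U : Matrix (Fin d) (Fin d) ℂ).mulVec v) - p) ^ (2 * m) ∂μ ≤ (8 * m * p / d) ^ m := by
  have h := sphInv_map μ hμ v hv
  haveI : IsProbabilityMeasure (μ.map fun U : Matrix.unitaryGroup (Fin d) ℂ =>
      (U : Matrix (Fin d) (Fin d) ℂ).mulVec v) :=
    Measure.isProbabilityMeasure_map (measurable_mv v).aemeasurable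
  have h2 := moment_bound h B p hp0 hp1 hd hpd m hm
  have hqm := measurable_qS B
  rw [integral_map (measurable_mv v).aemeasurable
    (by fun_prop : Measurable fun x => (qS B x - p) ^ (2 * m)).aestronglyMeasurable] at h2
  exact h2

lemma sum_prod_pow {d : ℕ} {R : Type*} [CommSemiring R] (t : ℕ) (f : Fin d → R) :
    ∑ a : Fin t → Fin d, ∏ k, f (a k) = (∑ i, f i) ^ t := by
  have := Finset.prod_univ_sum (fun _ : Fin t => (Finset.univ : Finset (Fin d)))
    (fun _ i => f i)
  rw [Fintype.piFinset_univ] at this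
  rw [← this]
  simp

/-- tensor power of a vector -/
def vpow {d : ℕ} (v : Fin d → ℂ) (t : ℕ) : (Fin t → Fin d) → ℂ := fun a => ∏ k, v (a k)

lemma tpow_mulVec {d : ℕ} (U : Matrix (Fin d) (Fin d) ℂ) (v : Fin d → ℂ) (t : ℕ) :
    (tpow U t).mulVec (vpow v t) = vpow (U.mulVec v) t := by
  funext a
  simp only [Matrix.mulVec, dotProduct, tpow, vpow, Matrix.of_apply, ← Finset.prod_mul_distrib]
  have := Finset.prod_univ_sum (fun _ : Fin t => (Finset.univ : Finset (Fin d)))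
    (fun k i => U (a k) i * v i)
  rw [Fintype.piFinset_univ] at this
  exact this.symm

lemma tpow_conj {d : ℕ} (U : Matrix (Fin d) (Fin d) ℂ) (t : ℕ) :
    tpow Uᴴ t = (tpow U t)ᴴ := by
  ext a b
  simp [tpow, Matrix.conjTranspose_apply]

lemma conjAct_vpow {d : ℕ} (U : Matrix (Fin d) (Fin d) ℂ) (v : Fin d → ℂ) (t : ℕ) :
    conjAct t U (Matrix.vecMulVec (vpow v t) (star (vpow v t))) =
      Matrix.vecMulVec (vpow (U.mulVec v) t) (star (vpow (U.mulVec v) t)) := by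
  unfold conjAct
  rw [tpow_conj, Matrix.mul_vecMulVec, Matrix.vecMulVec_mul, ← Matrix.star_mulVec, tpow_mulVec]

lemma vpow_diag {d : ℕ} (v : Fin d → ℂ) (t : ℕ) (a : Fin t → Fin d) :
    Matrix.vecMulVec (vpow v t) (star (vpow v t)) a a = ((∏ k, ‖v (a k)‖ ^ 2 : ℝ) : ℂ) := by
  rw [Matrix.vecMulVec_apply, Pi.star_apply, vpow]
  push_cast
  rw [star_prod, ← Finset.prod_mul_distrib]
  apply Finset.prod_congr rfl
  intro k _
  exact Complex.mul_conj' _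

lemma frob_vpow {d : ℕ} (v : Fin d → ℂ) (hv : qS Finset.univ v = 1) (t : ℕ) :
    frobNorm (Matrix.vecMulVec (vpow v t) (star (vpow v t))) = 1 := by
  have h : ∑ a : Fin t → Fin d, ‖vpow v t a‖ ^ 2 = 1 := by
    simp only [vpow, norm_prod, ← Finset.prod_pow]
    rw [sum_prod_pow t (fun i => ‖v i‖ ^ 2)]
    unfold qS at hv
    rw [hv, one_pow]
  unfold frobNorm
  simp only [Matrix.vecMulVec_apply, norm_mul, Pi.star_apply, norm_star, mul_pow,
    ← Finset.mul_sum, h, mul_one, Real.sqrt_one]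

lemma weight_sum {d : ℕ} (B : Finset (Fin d)) (p : ℝ) (y : Fin d → ℂ) (hy : qS Finset.univ y = 1) :
    ∑ i, ((if i ∈ B then (1:ℝ) else 0) - p) * ‖y i‖ ^ 2 = qS B y - p := by
  have : ∑ i, ((if i ∈ B then (1:ℝ) else 0) - p) * ‖y i‖ ^ 2
      = ∑ i, (if i ∈ B then ‖y i‖ ^ 2 else 0) - p * ∑ i, ‖y i‖ ^ 2 := by
    rw [Finset.mul_sum, ← Finset.sum_sub_distrib]
    apply Finset.sum_congr rfl
    intro i _
    split_ifs <;> ring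
  rw [this]
  unfold qS at *
  rw [hy, Finset.sum_ite_mem]
  simp

lemma weight_sq {d : ℕ} (B : Finset (Fin d)) (p : ℝ) (hd : 0 < d) (hpd : p = B.card / d) :
    ∑ i : Fin d, ((if i ∈ B then (1:ℝ) else 0) - p) ^ 2 ≤ B.card := by
  have hd' : (0:ℝ) < d := by exact_mod_cast hd
  have hBd : (B.card : ℝ) = p * d := by rw [hpd]; field_simp
  have : ∑ i : Fin d, ((if i ∈ B then (1:ℝ) else 0) - p) ^ 2
      = ∑ i : Fin d, (if i ∈ B then (1 - 2 * p) else 0) + ∑ i : Fin d, p ^ 2 := by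
    rw [← Finset.sum_add_distrib]
    apply Finset.sum_congr rfl
    intro i _
    split_ifs <;> ring
  rw [this, Finset.sum_ite_mem]
  simp only [Finset.univ_inter, Finset.sum_const, nsmul_eq_mul, Finset.card_univ, Fintype.card_fin]
  rw [hBd]
  nlinarith [mul_nonneg hd'.le (sq_nonneg p)]

lemma tpe_moment {d s : ℕ} (μ : Measure (Matrix.unitaryGroup (Fin d) ℂ)) [IsProbabilityMeasure μ]
    (m : ℕ) (lam Lam : ℝ) (hlam : lam ≤ Lam) (hLam : 0 ≤ Lam)
    (V : Fin s → Matrix.unitaryGroup (Fin d) ℂ)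
    (hV : IsTPE μ (2 * m) lam V) (v : Fin d → ℂ) (hv : qS Finset.univ v = 1)
    (B : Finset (Fin d)) (p : ℝ) (hd : 0 < d) (hpd : p = B.card / d) :
    (s : ℝ)⁻¹ * ∑ k, (qS B ((V k : Matrix (Fin d) (Fin d) ℂ).mulVec v) - p) ^ (2 * m) ≤
      ∫ U : Matrix.unitaryGroup (Fin d) ℂ,
      (qS B ((U : Matrix (Fin d) (Fin d) ℂ).mulVec v) - p) ^ (2 * m) ∂μ + Lam * B.card ^ m := by
  let w : Fin d → ℝ := fun i => (if i ∈ B then (1:ℝ) else 0) - p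
  let A : (Fin (2 * m) → Fin d) → ℝ := fun a => ∏ k, w (a k)
  let R : Matrix.unitaryGroup (Fin d) ℂ → (Fin (2 * m) → Fin d) → ℝ := fun U a =>
    ∏ k, ‖(U : Matrix (Fin d) (Fin d) ℂ).mulVec v (a k)‖ ^ 2
  let r : (Fin (2 * m) → Fin d) → ℝ := fun a =>
    (s : ℝ)⁻¹ * ∑ k, R (V k) a - ∫ U, R U a ∂μ
  have hAR : ∀ U : Matrix.unitaryGroup (Fin d) ℂ, ∑ a, A a * R U a =
      (qS B ((U : Matrix (Fin d) (Fin d) ℂ).mulVec v) - p) ^ (2 * m) := by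
    intro U
    simp only [A, R, ← Finset.prod_mul_distrib]
    rw [sum_prod_pow (2 * m) (fun i => w i * ‖(U : Matrix (Fin d) (Fin d) ℂ).mulVec v i‖ ^ 2),
      weight_sum B p _ (by rw [unitary_qS, hv])]
  have hRi : ∀ a, Integrable (fun U => R U a) μ := by
    intro a
    have hm := measurable_mv v
    have : ∀ i, Measurable fun U : Matrix.unitaryGroup (Fin d) ℂ =>
        (U : Matrix (Fin d) (Fin d) ℂ).mulVec v i := fun i => (measurable_pi_apply i).comp hm
    apply Integrable.of_bound (C := 1)
    · apply Measurable.aestronglyMeasurable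
      apply Finset.measurable_prod
      intro k _
      exact (this (a k)).norm.pow_const 2
    · filter_upwards with U
      rw [Real.norm_of_nonneg (Finset.prod_nonneg fun _ _ => by positivity)]
      apply Finset.prod_le_one
      · intro _ _; positivity
      · intro k _
        refine (sq_le_qS _ _).trans ?_
        rw [unitary_qS, hv]
  have hAr : ∑ a, A a * r a =
      (s : ℝ)⁻¹ * ∑ k, (qS B ((V k : Matrix (Fin d) (Fin d) ℂ).mulVec v) - p) ^ (2 * m) -
      ∫ U : Matrix.unitaryGroup (Fin d) ℂ,
      (qS B ((U : Matrix (Fin d) (Fin d) ℂ).mulVec v) - p) ^ (2 * m) ∂μ := by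
    simp only [← hAR]
    rw [integral_finset_sum _ (fun a _ => (hRi a).const_mul _)]
    simp only [integral_const_mul]
    rw [Finset.sum_comm, Finset.mul_sum, ← Finset.sum_sub_distrib]
    apply Finset.sum_congr rfl
    intro a _
    simp only [r]
    rw [← Finset.mul_sum]
    ring
  have hD := hV (Matrix.vecMulVec (vpow v (2 * m)) (star (vpow v (2 * m))))
  rw [frob_vpow v hv, mul_one] at hD
  set D := ((Fintype.card (Fin s) : ℂ)⁻¹ •
        (∑ i, conjAct (2 * m) ((V i : Matrix (Fin d) (Fin d) ℂ))
          (Matrix.vecMulVec (vpow v (2 * m)) (star (vpow v (2 * m))))) -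
          haarAvg μ (2 * m) (Matrix.vecMulVec (vpow v (2 * m)) (star (vpow v (2 * m))))) with hDdef
  have hDr : ∀ a, D a a = (r a : ℂ) := by
    intro a
    rw [hDdef]
    simp only [Matrix.sub_apply, Matrix.smul_apply, Matrix.sum_apply, conjAct_vpow, vpow_diag,
      haarAvg, Matrix.of_apply, Fintype.card_fin, r, R, smul_eq_mul]
    rw [integral_complex_ofReal]
    push_cast
    ring
  have hr : Real.sqrt (∑ a, r a ^ 2) ≤ Lam := by
    refine le_trans ?_ (hD.trans hlam)
    unfold frobNorm
    apply Real.sqrt_le_sqrt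
    apply Finset.sum_le_sum
    intro a _
    have : r a ^ 2 = ‖D a a‖ ^ 2 := by rw [hDr]; simp
    rw [this]
    exact Finset.single_le_sum (f := fun b => ‖D a b‖ ^ 2) (fun _ _ => by positivity)
      (Finset.mem_univ a)
  have hA : Real.sqrt (∑ a, A a ^ 2) ≤ (B.card : ℝ) ^ m := by
    simp only [A, ← Finset.prod_pow]
    rw [sum_prod_pow (2 * m) (fun i => w i ^ 2)]
    apply Real.sqrt_le_iff.2
    refine ⟨by positivity, ?_⟩
    rw [← pow_mul, mul_comm m 2]
    exact pow_le_pow_left₀ (Finset.sum_nonneg fun _ _ => by positivity) (weight_sq B p hd hpd) _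
  have hcs := Real.sum_mul_le_sqrt_mul_sqrt Finset.univ A r
  rw [hAr] at hcs
  have : Real.sqrt (∑ a, A a ^ 2) * Real.sqrt (∑ a, r a ^ 2) ≤ (B.card : ℝ) ^ m * Lam := by
    gcongr
  linarith

/-- The coordinates of the `j`-th block. -/
def blk (d1 d2 j : ℕ) : Finset (Fin d1) := Finset.univ.filter fun a => a.val / d2 = j

lemma card_blk (d1 d2 j : ℕ) (h2 : 0 < d2) (hj : j < d1 / d2) : (blk d1 d2 j).card = d2 := by
  have hle : (j + 1) * d2 ≤ d1 := (Nat.mul_le_mul_right d2 hj).trans (Nat.div_mul_le_self d1 d2)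
  have : (blk d1 d2 j).image Fin.val = Finset.Ico (j * d2) ((j + 1) * d2) := by
    ext x
    simp only [blk, Finset.mem_image, Finset.mem_filter, Finset.mem_univ, true_and,
      Finset.mem_Ico]
    constructor
    · rintro ⟨a, ha, rfl⟩
      rw [Nat.div_eq_iff h2] at ha
      constructor
      · omega
      · rw [Nat.add_mul]; omega
    · rintro ⟨h3, h4⟩
      refine ⟨⟨x, h4.trans_le hle⟩, ?_, rfl⟩
      rw [Nat.div_eq_iff h2]
      rw [Nat.add_mul] at h4
      simp only
      omega
  rw [← Finset.card_image_of_injective _ Fin.val_injective, this, Nat.card_Ico, Nat.add_mul]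
  omega

lemma projVec_apply (d1 d2 j : ℕ) (U : Matrix.unitaryGroup (Fin d1) ℂ) (v : Fin d1 → ℂ)
    (a : Fin d1) : projVec d1 d2 j U v a =
      if a ∈ blk d1 d2 j then (U : Matrix (Fin d1) (Fin d1) ℂ).mulVec v a else 0 := by
  simp only [projVec, blockProj, Matrix.mulVec_diagonal, blk, Finset.mem_filter, Finset.mem_univ,
    true_and]
  split_ifs <;> simp

lemma l2norm_projVec (d1 d2 j : ℕ) (U : Matrix.unitaryGroup (Fin d1) ℂ) (v : Fin d1 → ℂ) :
    l2norm (projVec d1 d2 j U v) =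
      Real.sqrt (qS (blk d1 d2 j) ((U : Matrix (Fin d1) (Fin d1) ℂ).mulVec v)) := by
  unfold l2norm qS
  congr 1
  simp only [projVec_apply]
  rw [← Finset.univ_inter (blk d1 d2 j), ← Finset.sum_ite_mem]
  apply Finset.sum_congr rfl
  intro a _
  rw [Finset.univ_inter]
  split_ifs <;> simp

/-- Partial inner product. -/
def hS {d : ℕ} (B : Finset (Fin d)) (x y : Fin d → ℂ) : ℂ := ∑ a ∈ B, (starRingEnd ℂ) (x a) * y a

lemma hinner_norm (d1 d2 j : ℕ) (U : Matrix.unitaryGroup (Fin d1) ℂ) (v w : Fin d1 → ℂ) :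
    hinner (normProjVec d1 d2 j U v) (normProjVec d1 d2 j U w) =
      (((l2norm (projVec d1 d2 j U v) * l2norm (projVec d1 d2 j U w))⁻¹ : ℝ) : ℂ) *
      hS (blk d1 d2 j) ((U : Matrix (Fin d1) (Fin d1) ℂ).mulVec v)
        ((U : Matrix (Fin d1) (Fin d1) ℂ).mulVec w) := by
  unfold hinner normProjVec hS
  rw [← Finset.univ_inter (blk d1 d2 j), ← Finset.sum_ite_mem, Finset.mul_sum]
  apply Finset.sum_congr rfl
  intro a _
  simp only [Pi.smul_apply, projVec_apply, Complex.real_smul]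
  split_ifs
  · simp only [map_mul, Complex.conj_ofReal]
    push_cast
    rw [mul_inv]
    ring
  · simp

lemma hinner_unitary {d : ℕ} (U : Matrix.unitaryGroup (Fin d) ℂ) (v w : Fin d → ℂ) :
    hinner v w = hS Finset.univ ((U : Matrix (Fin d) (Fin d) ℂ).mulVec v)
        ((U : Matrix (Fin d) (Fin d) ℂ).mulVec w) := by
  have h : ∀ v w : Fin d → ℂ, hS Finset.univ v w = star v ⬝ᵥ w := fun v w => rfl
  have h' : ∀ v w : Fin d → ℂ, hinner v w = star v ⬝ᵥ w := fun v w => rfl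
  rw [h, h', Matrix.star_mulVec, ← Matrix.dotProduct_mulVec, Matrix.mulVec_mulVec,
      ← Matrix.star_eq_conjTranspose, Matrix.UnitaryGroup.star_mul_self, Matrix.one_mulVec]

lemma qS_add {d : ℕ} (B : Finset (Fin d)) (x y : Fin d → ℂ) (τ : ℂ) (hτ : ‖τ‖ = 1) :
    qS B (x + τ • y) = qS B x + qS B y + 2 * (τ * hS B x y).re := by
  unfold qS hS
  rw [Finset.mul_sum, Complex.re_sum, Finset.mul_sum, ← Finset.sum_add_distrib,
    ← Finset.sum_add_distrib]
  apply Finset.sum_congr rfl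
  intro a _
  have h : τ.re * τ.re + τ.im * τ.im = 1 := by
    rw [← Complex.normSq_apply, Complex.normSq_eq_norm_sq, hτ]; norm_num
  simp only [Pi.add_apply, Pi.smul_apply, smul_eq_mul, Complex.sq_norm, Complex.normSq_apply,
    Complex.add_re, Complex.add_im, Complex.mul_re, Complex.mul_im, Complex.conj_re,
    Complex.conj_im]
  linear_combination ((y a).re * (y a).re + (y a).im * (y a).im) * h

/-- The good event for a vector. -/
def good {d : ℕ} (B : Finset (Fin d)) (p η : ℝ) (x : Fin d → ℂ) : Prop :=
  |qS B x - p * qS Finset.univ x| ≤ η * p * qS Finset.univ x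

lemma real_final (h z r p ε : ℝ) (hp : 0 < p) (hε : 0 < ε) (hε' : ε < 1 / 4)
    (h1 : |h - p * z| ≤ (2 * ε - ε ^ 2) * p) (hz : |z| ≤ 1)
    (hr1 : p * (1 - ε) ^ 2 ≤ r) (hr2 : r ≤ p * (1 + (2 * ε - ε ^ 2))) :
    |r⁻¹ * h - z| ≤ 8 * ε := by
  have hr : 0 < r := lt_of_lt_of_le (by have : 0 < 1 - ε := by linarith
                                        positivity) hr1
  have e1 : r⁻¹ * h - z = (h - r * z) / r := by field_simp
  rw [e1, abs_div, abs_of_pos hr, div_le_iff₀ hr]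
  have e2 : |(r - p) * z| ≤ (2 * ε - ε ^ 2) * p := by
    rw [abs_mul]
    have : |r - p| ≤ (2 * ε - ε ^ 2) * p := by rw [abs_le]; constructor <;> nlinarith
    nlinarith [abs_nonneg (r - p), abs_nonneg z]
  have e3 : h - r * z = (h - p * z) - (r - p) * z := by ring
  rw [e3]
  refine (abs_sub _ _).trans ?_
  have e4 : 2 * (2 * ε - ε ^ 2) ≤ 8 * ε * (1 - ε) ^ 2 := by nlinarith [mul_pos hε hε]
  nlinarith

lemma abs_hS_le {d : ℕ} (x y : Fin d → ℂ) (hx : qS Finset.univ x = 1) (hy : qS Finset.univ y = 1)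
    (τ : ℂ) (hτ : ‖τ‖ = 1) : |(τ * hS Finset.univ x y).re| ≤ 1 := by
  have h1 := qS_add Finset.univ x y τ hτ
  have h2 := qS_add Finset.univ x y (-τ) (by rw [norm_neg, hτ])
  have h3 := qS_nonneg Finset.univ (x + τ • y)
  have h4 := qS_nonneg Finset.univ (x + (-τ) • y)
  rw [neg_mul, Complex.neg_re] at h2
  rw [abs_le]
  constructor <;> linarith

lemma re_close {d : ℕ} (B : Finset (Fin d)) (p η : ℝ) (x y : Fin d → ℂ)
    (hx : qS Finset.univ x = 1) (hy : qS Finset.univ y = 1)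
    (τ : ℂ) (hτ : ‖τ‖ = 1) (g1 : good B p η (x + τ • y)) (g2 : good B p η (x + (-τ) • y)) :
    |(τ * hS B x y).re - p * (τ * hS Finset.univ x y).re| ≤ η * p := by
  have h1 := qS_add Finset.univ x y τ hτ
  have h2 := qS_add Finset.univ x y (-τ) (by rw [norm_neg, hτ])
  have h3 := qS_add B x y τ hτ
  have h4 := qS_add B x y (-τ) (by rw [norm_neg, hτ])
  rw [neg_mul, Complex.neg_re] at h2 h4
  unfold good at g1 g2
  rw [h1, h3, hx, hy] at g1
  rw [h2, h4, hx, hy] at g2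
  rw [abs_le] at *
  obtain ⟨a1, a2⟩ := g1
  obtain ⟨b1, b2⟩ := g2
  constructor <;> linarith

lemma good_double {d : ℕ} (B : Finset (Fin d)) (p η : ℝ) (x : Fin d → ℂ)
    (g : good B p η (x + (1:ℂ) • x)) : good B p η x := by
  have h : ∀ B : Finset (Fin d), qS B (x + (1:ℂ) • x) = 4 * qS B x := by
    intro B
    unfold qS
    rw [Finset.mul_sum]
    apply Finset.sum_congr rfl
    intro a _
    have : (x + (1:ℂ) • x) a = 2 * x a := by simp; ring
    rw [this, norm_mul, mul_pow]
    norm_num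
  unfold good at *
  rw [h, h] at g
  rw [abs_le] at *
  obtain ⟨a1, a2⟩ := g
  constructor <;> linarith

lemma good_norm {d : ℕ} (B : Finset (Fin d)) (p ε : ℝ) (hp : 0 < p) (hε : 0 < ε)
    (hε' : ε < 1 / 4) (x : Fin d → ℂ) (hx : qS Finset.univ x = 1)
    (g : good B p (2 * ε - ε ^ 2) x) :
    (p * (1 - ε) ^ 2 ≤ qS B x ∧ qS B x ≤ p * (1 + (2 * ε - ε ^ 2))) ∧
    (1 - ε) * Real.sqrt p ≤ Real.sqrt (qS B x) ∧
      Real.sqrt (qS B x) ≤ (1 + ε) * Real.sqrt p := by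
  unfold good at g
  rw [hx, abs_le] at g
  obtain ⟨a1, a2⟩ := g
  have b1 : p * (1 - ε) ^ 2 ≤ qS B x := by nlinarith
  have b2 : qS B x ≤ p * (1 + (2 * ε - ε ^ 2)) := by nlinarith
  refine ⟨⟨b1, b2⟩, ?_, ?_⟩
  · apply Real.le_sqrt_of_sq_le
    rw [mul_pow, Real.sq_sqrt hp.le]
    linarith
  · apply Real.sqrt_le_iff.2
    refine ⟨by positivity, ?_⟩
    rw [mul_pow, Real.sq_sqrt hp.le]
    nlinarith [mul_pos hp (mul_pos hε hε)]

lemma det_inner {d : ℕ} (B : Finset (Fin d)) (p ε : ℝ) (hp : 0 < p) (hε : 0 < ε)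
    (hε' : ε < 1 / 4) (x y : Fin d → ℂ) (hx : qS Finset.univ x = 1) (hy : qS Finset.univ y = 1)
    (gx : good B p (2 * ε - ε ^ 2) x) (gy : good B p (2 * ε - ε ^ 2) y)
    (g : ∀ k : Fin 4, good B p (2 * ε - ε ^ 2) (x + (Complex.I ^ (k : ℕ)) • y)) :
    |((((Real.sqrt (qS B x) * Real.sqrt (qS B y))⁻¹ : ℝ) : ℂ) * hS B x y
      - hS Finset.univ x y).re| ≤ 8 * ε ∧
    |((((Real.sqrt (qS B x) * Real.sqrt (qS B y))⁻¹ : ℝ) : ℂ) * hS B x y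
      - hS Finset.univ x y).im| ≤ 8 * ε := by
  have g0 := g 0
  have g1 := g 1
  have g2 := g 2
  have g3 := g 3
  simp only [Fin.val_zero, Fin.val_one, Fin.val_two, pow_zero, pow_one, Complex.I_sq] at g0 g1 g2
  rw [show ((3 : Fin 4) : ℕ) = 3 from rfl, Complex.I_pow_three] at g3
  have c0 := re_close B p _ x y hx hy 1 (by simp) g0 g2
  have c1 := re_close B p _ x y hx hy Complex.I (by simp) g1 g3
  have z0 := abs_hS_le x y hx hy 1 (by simp)
  have z1 := abs_hS_le x y hx hy Complex.I (by simp)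
  rw [one_mul, one_mul] at c0
  rw [one_mul] at z0
  simp only [Complex.I_mul_re] at c1 z1
  obtain ⟨⟨a1, a2⟩, -⟩ := good_norm B p ε hp hε hε' x hx gx
  obtain ⟨⟨b1, b2⟩, -⟩ := good_norm B p ε hp hε hε' y hy gy
  set r := Real.sqrt (qS B x) * Real.sqrt (qS B y) with hr
  have hpe : 0 ≤ p * (1 - ε) ^ 2 := by positivity
  have hr1 : p * (1 - ε) ^ 2 ≤ r := by
    rw [← Real.mul_self_sqrt hpe, hr]
    exact mul_le_mul (Real.sqrt_le_sqrt a1) (Real.sqrt_le_sqrt b1) (Real.sqrt_nonneg _)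
      (Real.sqrt_nonneg _)
  have hr2 : r ≤ p * (1 + (2 * ε - ε ^ 2)) := by
    have : 0 ≤ p * (1 + (2 * ε - ε ^ 2)) := (qS_nonneg B x).trans a2
    rw [← Real.mul_self_sqrt this, hr]
    exact mul_le_mul (Real.sqrt_le_sqrt a2) (Real.sqrt_le_sqrt b2) (Real.sqrt_nonneg _)
      (Real.sqrt_nonneg _)
  rw [Complex.sub_re, Complex.sub_im, Complex.re_ofReal_mul, Complex.im_ofReal_mul]
  refine ⟨real_final _ _ _ p ε hp hε hε' c0 z0 hr1 hr2, ?_⟩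
  refine real_final _ _ _ p ε hp hε hε' ?_ ?_ hr1 hr2
  · rw [← abs_neg]; convert c1 using 2; ring
  · rw [← abs_neg]; exact z1

lemma num_bound (p ε d1 d2 : ℝ) (m : ℕ) (hm0 : 0 < m) (hm : (m : ℝ) = ε ^ 2 * d2 / 2 ^ 10)
    (hε : 0 < ε) (hε' : ε < 1 / 4) (hd1 : 0 < d1) (hd2 : 0 < d2) (hp : p = d2 / d1) :
    (8 * m * p / d1) ^ m + (4 * ε ^ 2 * d2 / d1 ^ 2) ^ m * Real.exp (-(m : ℝ)) * d2 ^ m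
      ≤ (1 / 2) ^ m * ((2 * ε - ε ^ 2) * p) ^ (2 * m) := by
  have hp0 : 0 < p := by rw [hp]; positivity
  have e1 : 8 * m * p / d1 = (1 / 128) * (ε * p) ^ 2 := by
    rw [hm, hp]; field_simp; norm_num
  have e2 : (4 * ε ^ 2 * d2 / d1 ^ 2) ^ m * Real.exp (-(m : ℝ)) * d2 ^ m
      = ((4 * Real.exp (-1)) * (ε * p) ^ 2) ^ m := by
    have : Real.exp (-(m : ℝ)) = Real.exp (-1) ^ m := by
      rw [← Real.exp_nat_mul]; congr 1; ring
    rw [this, ← mul_pow, ← mul_pow, hp]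
    congr 1
    field_simp
  rw [e1, e2, pow_mul, ← mul_pow]
  have he : Real.exp (-1) ≤ 0.37 := by
    rw [Real.exp_neg, inv_le_comm₀ (Real.exp_pos _) (by norm_num)]
    have := Real.exp_one_gt_d9
    norm_num at *
    linarith
  have hE := Real.exp_pos (-1)
  refine (pow_add_pow_le (by positivity) (by positivity) hm0.ne').trans ?_
  apply pow_le_pow_left₀ (by positivity)
  have h1 : (7 / 4) * ε ≤ 2 * ε - ε ^ 2 := by nlinarith
  have h2 : ((7 / 4) * (ε * p)) ^ 2 ≤ ((2 * ε - ε ^ 2) * p) ^ 2 := by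
    apply pow_le_pow_left₀ (by positivity)
    nlinarith
  have h3 : 0 ≤ (ε * p) ^ 2 := by positivity
  nlinarith

lemma bad_unit {d1 d2 s : ℕ} (μ : Measure (Matrix.unitaryGroup (Fin d1) ℂ))
    [IsProbabilityMeasure μ]
    (hμ : ∀ V : Matrix.unitaryGroup (Fin d1) ℂ, μ.map (fun U => V * U) = μ)
    (m : ℕ) (hm0 : 0 < m) (ε : ℝ) (hm : (m : ℝ) = ε ^ 2 * d2 / 2 ^ 10)
    (hε : 0 < ε) (hε' : ε < 1 / 4) (hd2 : 0 < d2) (hd : d2 < d1) (hs : 0 < s) (lam : ℝ)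
    (hlam : lam ≤ (4 * ε ^ 2 * d2 / (d1 : ℝ) ^ 2) ^ m * Real.exp (-(m : ℝ)))
    (V : Fin s → Matrix.unitaryGroup (Fin d1) ℂ)
    (hV : IsTPE μ (2 * m) lam V) (v : Fin d1 → ℂ) (hv : qS Finset.univ v = 1)
    (B : Finset (Fin d1)) (hB : B.card = d2) (S : Finset (Fin s))
    (hS : ∀ k ∈ S, ¬ good B ((d2 : ℝ) / d1) (2 * ε - ε ^ 2)
      ((V k : Matrix (Fin d1) (Fin d1) ℂ).mulVec v)) :
    (S.card : ℝ) ≤ s * (1 / 2) ^ m := by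
  have hd1' : (0:ℝ) < d1 := by exact_mod_cast hd2.trans hd
  have hd2' : (0:ℝ) < d2 := by exact_mod_cast hd2
  have hs' : (0:ℝ) < s := by exact_mod_cast hs
  set p : ℝ := (d2 : ℝ) / d1 with hp
  have hp0 : 0 < p := by positivity
  have hp1 : p ≤ 1 := by rw [hp, div_le_one hd1']; exact_mod_cast hd.le
  have hpd : p = (B.card : ℝ) / d1 := by rw [hB]
  have hmp : (m : ℝ) ≤ p * d1 := by
    rw [hm, hp, div_mul_cancel₀ _ hd1'.ne', div_le_iff₀ (by norm_num)]
    have : ε ^ 2 ≤ 2 ^ 10 := by nlinarith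
    have := mul_le_mul_of_nonneg_right this hd2'.le
    linarith
  have h1 := haar_moment μ hμ v hv B p hp0 hp1 (hd2.trans hd) hpd m hmp
  have h2 := tpe_moment μ m lam _ hlam (by positivity) V hV v hv B p (hd2.trans hd) hpd
  have h3 := num_bound p ε d1 d2 m hm0 hm hε hε' hd1' hd2' hp
  rw [hB] at h2
  set η := 2 * ε - ε ^ 2 with hη
  have hη0 : 0 < η := by nlinarith
  have h4 : (s : ℝ)⁻¹ * ∑ k, (qS B ((V k : Matrix (Fin d1) (Fin d1) ℂ).mulVec v) - p) ^ (2 * m)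
      ≤ (1 / 2) ^ m * (η * p) ^ (2 * m) := by linarith
  have h5 : (S.card : ℝ) * (η * p) ^ (2 * m) ≤
      ∑ k, (qS B ((V k : Matrix (Fin d1) (Fin d1) ℂ).mulVec v) - p) ^ (2 * m) := by
    rw [← nsmul_eq_mul]
    refine (Finset.card_nsmul_le_sum S
      (fun k => (qS B ((V k : Matrix (Fin d1) (Fin d1) ℂ).mulVec v) - p) ^ (2 * m)) _ ?_).trans
      (Finset.sum_le_sum_of_subset_of_nonneg (Finset.subset_univ _)
        fun k _ _ => by rw [pow_mul]; positivity)
    intro k hk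
    have := hS k hk
    unfold good at this
    rw [unitary_qS, hv, not_le, mul_one, mul_one] at this
    rw [← (even_two_mul m).pow_abs (qS B _ - p)]
    exact pow_le_pow_left₀ (by positivity) this.le _
  have h6 : ∑ k, (qS B ((V k : Matrix (Fin d1) (Fin d1) ℂ).mulVec v) - p) ^ (2 * m)
      ≤ s * ((1 / 2) ^ m * (η * p) ^ (2 * m)) := by
    rwa [inv_mul_le_iff₀ hs'] at h4
  have h7 : 0 < (η * p) ^ (2 * m) := by positivity
  refine le_of_mul_le_mul_right ?_ h7
  calc _ ≤ _ := h5
    _ ≤ _ := h6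
    _ = _ := by ring

lemma qS_smul {d : ℕ} (B : Finset (Fin d)) (c : ℂ) (x : Fin d → ℂ) :
    qS B (c • x) = ‖c‖ ^ 2 * qS B x := by
  unfold qS
  rw [Finset.mul_sum]
  apply Finset.sum_congr rfl
  intro a _
  rw [Pi.smul_apply, smul_eq_mul, norm_mul, mul_pow]

lemma bad_any {d1 d2 s : ℕ} (μ : Measure (Matrix.unitaryGroup (Fin d1) ℂ))
    [IsProbabilityMeasure μ]
    (hμ : ∀ V : Matrix.unitaryGroup (Fin d1) ℂ, μ.map (fun U => V * U) = μ)
    (m : ℕ) (hm0 : 0 < m) (ε : ℝ) (hm : (m : ℝ) = ε ^ 2 * d2 / 2 ^ 10)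
    (hε : 0 < ε) (hε' : ε < 1 / 4) (hd2 : 0 < d2) (hd : d2 < d1) (hs : 0 < s) (lam : ℝ)
    (hlam : lam ≤ (4 * ε ^ 2 * d2 / (d1 : ℝ) ^ 2) ^ m * Real.exp (-(m : ℝ)))
    (V : Fin s → Matrix.unitaryGroup (Fin d1) ℂ)
    (hV : IsTPE μ (2 * m) lam V) (u : Fin d1 → ℂ)
    (B : Finset (Fin d1)) (hB : B.card = d2) (S : Finset (Fin s))
    (hS : ∀ k ∈ S, ¬ good B ((d2 : ℝ) / d1) (2 * ε - ε ^ 2)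
      ((V k : Matrix (Fin d1) (Fin d1) ℂ).mulVec u)) :
    (S.card : ℝ) ≤ s * (1 / 2) ^ m := by
  by_cases hu : qS Finset.univ u = 0
  · have : S = ∅ := by
      apply Finset.eq_empty_of_forall_notMem
      intro k hk
      apply hS k hk
      have h1 := qS_le B ((V k : Matrix (Fin d1) (Fin d1) ℂ).mulVec u)
      have h2 := qS_nonneg B ((V k : Matrix (Fin d1) (Fin d1) ℂ).mulVec u)
      have h3 := unitary_qS (V k) u
      rw [hu] at h3
      rw [h3] at h1
      unfold good
      rw [h3, le_antisymm h1 h2]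
      simp
    rw [this]
    simp
  · have hu0 : 0 < qS Finset.univ u := lt_of_le_of_ne (qS_nonneg _ _) (Ne.symm hu)
    set c : ℝ := (Real.sqrt (qS Finset.univ u))⁻¹ with hc
    have hc0 : 0 < c := by positivity
    have hc2 : c ^ 2 * qS Finset.univ u = 1 := by
      rw [hc, inv_pow, Real.sq_sqrt hu0.le, inv_mul_cancel₀ hu]
    have hn : ‖(c : ℂ)‖ ^ 2 = c ^ 2 := by simp
    refine bad_unit μ hμ m hm0 ε hm hε hε' hd2 hd hs lam hlam V hV ((c : ℂ) • u) ?_ B hB S ?_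
    · rw [qS_smul, hn, hc2]
    · intro k hk hg
      apply hS k hk
      rw [Matrix.mulVec_smul] at hg
      unfold good at *
      rw [qS_smul, qS_smul, hn] at hg
      have hcc : 0 < c ^ 2 := by positivity
      rw [show ∀ a b q : ℝ, c ^ 2 * a - q * (c ^ 2 * b) = c ^ 2 * (a - q * b) from
        fun a b q => by ring, abs_mul, abs_of_pos hcc] at hg
      refine le_of_mul_le_mul_left ?_ hcc
      refine hg.trans (le_of_eq (by ring))

lemma final_num (n d1 : ℕ) (δ ε d2 : ℝ) (m N : ℕ) (hn : 0 < n) (hd1 : 0 < d1) (hδ : 0 < δ)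
    (hδ' : δ < 1 / 4) (hε : 0 < ε) (hC : 8192 * ε⁻¹ ^ 2 * Real.log ((n : ℝ) * d1 / δ) ≤ d2)
    (hm : (m : ℝ) = ε ^ 2 * d2 / 2 ^ 10) (hN : N ≤ d1) :
    (n * (n * (4 * N)) : ℝ) * (1 / 2) ^ m ≤ δ := by
  have hn' : (1:ℝ) ≤ n := by exact_mod_cast hn
  have hd1' : (1:ℝ) ≤ d1 := by exact_mod_cast hd1
  have hN' : (N:ℝ) ≤ d1 := by exact_mod_cast hN
  set L := Real.log ((n : ℝ) * d1 / δ) with hL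
  have hX : 0 < (n : ℝ) * d1 / δ := by positivity
  have hX1 : 1 ≤ (n : ℝ) * d1 / δ := by
    rw [le_div_iff₀ hδ]; nlinarith
  have hL0 : 0 ≤ L := Real.log_nonneg hX1
  have hmL : 8 * L ≤ m := by
    rw [hm, le_div_iff₀ (by norm_num)]
    have := mul_le_mul_of_nonneg_left hC (by positivity : 0 ≤ ε ^ 2)
    have e : ε ^ 2 * (8192 * ε⁻¹ ^ 2 * L) = 8192 * L := by field_simp
    rw [e] at this
    linarith
  have h1 : ((1:ℝ) / 2) ^ m ≤ (δ / (n * d1)) ^ 4 := by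
    have e1 : ((1:ℝ) / 2) ^ m = Real.exp (-(m * Real.log 2)) := by
      rw [Real.exp_neg, Real.exp_nat_mul, Real.exp_log (by norm_num)]; simp
    have e2 : (δ / (n * d1)) ^ 4 = Real.exp (-(4 * L)) := by
      have : δ / (n * d1) = ((n : ℝ) * d1 / δ)⁻¹ := by rw [inv_div]
      rw [this, Real.exp_neg, inv_pow]
      congr 1
      rw [show (4:ℝ) * L = (4:ℕ) * L by norm_num, Real.exp_nat_mul, hL, Real.exp_log hX]
    rw [e1, e2]
    apply Real.exp_le_exp.2
    have := Real.log_two_gt_d9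
    nlinarith
  have h2 : (n * (n * (4 * N)) : ℝ) ≤ 4 * (n * d1) ^ 2 := by
    have : (N : ℝ) ≤ d1 ^ 2 := by nlinarith
    have := mul_le_mul_of_nonneg_left this (by positivity : (0:ℝ) ≤ 4 * n ^ 2)
    nlinarith
  calc _ ≤ 4 * ((n:ℝ) * d1) ^ 2 * (δ / (n * d1)) ^ 4 := by gcongr
    _ = 4 * δ ^ 4 / (n * d1) ^ 2 := by field_simp
    _ ≤ 4 * δ ^ 4 / 1 := by
      gcongr
      nlinarith [mul_le_mul hn' hd1' (by norm_num) (by positivity : (0:ℝ) ≤ n)]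
    _ ≤ δ := by
      have : δ ^ 3 ≤ (1 / 4) ^ 3 := pow_le_pow_left₀ hδ.le hδ'.le 3
      nlinarith

/-- **Theorem 3.2 (quantum Johnson–Lindenstrauss transform):** there is a universal constant
`C > 0` such that for any `0 < ε, δ < 1/4`, unit vectors `v₁, ..., vₙ ∈ ℂ^{d₁}`, and
`d₂ ∣ d₁`, `d₂ < d₁`, `d₂ ≥ C ε⁻² log(n d₁ / δ)`, if `U` is chosen uniformly at random from
the unitaries of a `(d₁, s, λ, 2m)`-TPE with `m = 2⁻¹⁰ ε² d₂` and
`λ ≤ (4ε²d₂/d₁²)^m e^{-m}`, then with probability at least `1 - δ`: (a) all the projected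
norms `‖Π_j U vᵢ‖₂` lie in `(1 ± ε)√(d₂/d₁)`, and (b) all normalized projected inner
products are within `8ε` of the original inner products, in real and imaginary parts. -/
theorem quantum_johnson_lindenstrauss :
    ∃ C : ℝ, 0 < C ∧
      ∀ (d1 d2 n : ℕ) (ε δ : ℝ), 0 < ε → ε < 1 / 4 → 0 < δ → δ < 1 / 4 →
        ∀ v : Fin n → (Fin d1 → ℂ), (∀ i, l2norm (v i) = 1) →
        d2 < d1 → d2 ∣ d1 → C * ε⁻¹ ^ 2 * Real.log ((n : ℝ) * d1 / δ) ≤ (d2 : ℝ) →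
        ∀ m : ℕ, 0 < m → (m : ℝ) = ε ^ 2 * d2 / 2 ^ 10 →
        ∀ (μ : Measure (Matrix.unitaryGroup (Fin d1) ℂ)), IsProbabilityMeasure μ →
        (∀ V : Matrix.unitaryGroup (Fin d1) ℂ, μ.map (fun U => V * U) = μ) →
        ∀ (s : ℕ), 0 < s → ∀ (lam : ℝ),
          lam ≤ (4 * ε ^ 2 * d2 / (d1 : ℝ) ^ 2) ^ m * Real.exp (-(m : ℝ)) →
        ∀ V : Fin s → Matrix.unitaryGroup (Fin d1) ℂ, IsTPE μ (2 * m) lam V →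
        (1 - δ) * s ≤
          ((Finset.univ.filter fun k : Fin s =>
            (∀ (i : Fin n) (j : ℕ), j < d1 / d2 →
              (1 - ε) * Real.sqrt ((d2 : ℝ) / d1) ≤ l2norm (projVec d1 d2 j (V k) (v i)) ∧
              l2norm (projVec d1 d2 j (V k) (v i)) ≤ (1 + ε) * Real.sqrt ((d2 : ℝ) / d1)) ∧
            (∀ (i i' : Fin n) (j : ℕ), j < d1 / d2 →
              |(hinner (normProjVec d1 d2 j (V k) (v i)) (normProjVec d1 d2 j (V k) (v i')) -
                  hinner (v i) (v i')).re| ≤ 8 * ε ∧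
              |(hinner (normProjVec d1 d2 j (V k) (v i)) (normProjVec d1 d2 j (V k) (v i')) -
                  hinner (v i) (v i')).im| ≤ 8 * ε)).card : ℝ) := by
  refine ⟨8192, by norm_num, ?_⟩
  intro d1 d2 n ε δ hε hε' hδ hδ' v hv hd hdvd hC m hm0 hm μ hprob hμ s hs lam hlam V hV
  have hd2 : 0 < d2 := by
    rcases Nat.eq_zero_or_pos d2 with h | h
    · rw [h] at hm
      have : (0:ℝ) < m := by exact_mod_cast hm0
      simp at hm
      omega
    · exact h
  have hd1 : 0 < d1 := hd2.trans hd
  have hd1' : (0:ℝ) < d1 := by exact_mod_cast hd1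
  have hd2' : (0:ℝ) < d2 := by exact_mod_cast hd2
  have hs' : (0:ℝ) < s := by exact_mod_cast hs
  have hp : 0 < (d2 : ℝ) / d1 := by positivity
  rcases Nat.eq_zero_or_pos n with hn | hn
  · subst hn
    rw [Finset.filter_true_of_mem]
    · simp only [Finset.card_univ, Fintype.card_fin]
      nlinarith
    · intro k _
      exact ⟨fun i => i.elim0, fun i => i.elim0⟩
  classical
  have hq : ∀ i, qS Finset.univ (v i) = 1 := by
    intro i
    have := hv i
    unfold l2norm at this
    rwa [Real.sqrt_eq_one] at this
  let P : Fin n × Fin n × Fin 4 × Fin (d1 / d2) → Fin s → Prop := fun t k =>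
    good (blk d1 d2 t.2.2.2) ((d2 : ℝ) / d1) (2 * ε - ε ^ 2)
      ((V k : Matrix (Fin d1) (Fin d1) ℂ).mulVec (v t.1 + (Complex.I ^ (t.2.2.1 : ℕ)) • v t.2.1))
  let bad : Finset (Fin s) := Finset.univ.biUnion fun t => Finset.univ.filter fun k => ¬ P t k
  have hbad : (bad.card : ℝ) ≤ δ * s := by
    have h1 : (bad.card : ℝ) ≤ ∑ t : Fin n × Fin n × Fin 4 × Fin (d1 / d2),
        ((Finset.univ.filter fun k => ¬ P t k).card : ℝ) := by
      exact_mod_cast Finset.card_biUnion_le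
    have h2 : ∑ t : Fin n × Fin n × Fin 4 × Fin (d1 / d2),
        ((Finset.univ.filter fun k => ¬ P t k).card : ℝ) ≤
        ∑ t : Fin n × Fin n × Fin 4 × Fin (d1 / d2), (s * (1 / 2) ^ m : ℝ) := by
      apply Finset.sum_le_sum
      intro t _
      apply bad_any μ hμ m hm0 ε hm hε hε' hd2 hd hs lam hlam V hV
        (v t.1 + (Complex.I ^ (t.2.2.1 : ℕ)) • v t.2.1) (blk d1 d2 t.2.2.2)
        (card_blk _ _ _ hd2 t.2.2.2.2)
      intro k hk
      exact (Finset.mem_filter.1 hk).2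
    rw [Finset.sum_const, nsmul_eq_mul] at h2
    simp only [Finset.card_univ, Fintype.card_prod, Fintype.card_fin] at h2
    have h3 := final_num n d1 δ ε d2 m (d1 / d2) hn hd1 hδ hδ' hε hC hm (Nat.div_le_self _ _)
    push_cast at h2 h3
    nlinarith
  have hsub : badᶜ ⊆ (Finset.univ.filter fun k : Fin s =>
            (∀ (i : Fin n) (j : ℕ), j < d1 / d2 →
              (1 - ε) * Real.sqrt ((d2 : ℝ) / d1) ≤ l2norm (projVec d1 d2 j (V k) (v i)) ∧
              l2norm (projVec d1 d2 j (V k) (v i)) ≤ (1 + ε) * Real.sqrt ((d2 : ℝ) / d1)) ∧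
            (∀ (i i' : Fin n) (j : ℕ), j < d1 / d2 →
              |(hinner (normProjVec d1 d2 j (V k) (v i)) (normProjVec d1 d2 j (V k) (v i')) -
                  hinner (v i) (v i')).re| ≤ 8 * ε ∧
              |(hinner (normProjVec d1 d2 j (V k) (v i)) (normProjVec d1 d2 j (V k) (v i')) -
                  hinner (v i) (v i')).im| ≤ 8 * ε)) := by
    intro k hk
    have hg : ∀ t, P t k := by
      intro t
      by_contra hcon
      apply Finset.mem_compl.1 hk
      exact Finset.mem_biUnion.2 ⟨t, Finset.mem_univ _, Finset.mem_filter.2 ⟨Finset.mem_univ _, hcon⟩⟩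
    have hqV : ∀ i, qS Finset.univ ((V k : Matrix (Fin d1) (Fin d1) ℂ).mulVec (v i)) = 1 :=
      fun i => by rw [unitary_qS, hq]
    have hgo : ∀ (i i' : Fin n) (j : ℕ), j < d1 / d2 → ∀ l : Fin 4,
        good (blk d1 d2 j) ((d2 : ℝ) / d1) (2 * ε - ε ^ 2)
          ((V k : Matrix (Fin d1) (Fin d1) ℂ).mulVec (v i) +
            (Complex.I ^ (l : ℕ)) • (V k : Matrix (Fin d1) (Fin d1) ℂ).mulVec (v i')) := by
      intro i i' j hj l
      have := hg (i, i', l, ⟨j, hj⟩)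
      simp only [P] at this
      rwa [Matrix.mulVec_add, Matrix.mulVec_smul] at this
    have hgs : ∀ (i : Fin n) (j : ℕ), j < d1 / d2 →
        good (blk d1 d2 j) ((d2 : ℝ) / d1) (2 * ε - ε ^ 2)
          ((V k : Matrix (Fin d1) (Fin d1) ℂ).mulVec (v i)) := by
      intro i j hj
      apply good_double
      simpa using hgo i i j hj 0
    rw [Finset.mem_filter]
    refine ⟨Finset.mem_univ _, ?_, ?_⟩
    · intro i j hj
      rw [l2norm_projVec]
      exact (good_norm _ _ ε hp hε hε' _ (hqV i) (hgs i j hj)).2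
    · intro i i' j hj
      rw [hinner_norm, hinner_unitary (V k) (v i) (v i'), l2norm_projVec, l2norm_projVec]
      exact det_inner _ _ ε hp hε hε' _ _ (hqV i) (hqV i') (hgs i j hj) (hgs i' j hj)
        (hgo i i' j hj)
  have hcard := Finset.card_le_card hsub
  have hc2 : ((badᶜ).card : ℝ) = s - bad.card := by
    rw [Finset.card_compl, Nat.cast_sub (Finset.card_le_univ _), Fintype.card_fin]
  have hc3 : (1 - δ) * s ≤ ((badᶜ).card : ℝ) := by rw [hc2]; linarith
  refine hc3.trans ?_
  convert (Nat.cast_le (α := ℝ)).2 hcard
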